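/- arXiv:1406.1582 — 2 statements merged into one kernel-verified Lean document; each statement's English description precedes it below -/
import Mathlib

section
/- No truth is unverifiable: for every formula A, IEL ⊢ ¬(¬K A ∧ ¬K¬A). -/
/-- Formulas of intuitionistic epistemic logic: atoms, ⊥, ∧, ∨, →, and the
epistemic operator `K`. `¬A` abbreviates `A → ⊥`. -/
inductive Formula : Type
  | atom : ℕ → Formula
  | bot  : Formula
  | and  : Formula → Formula → Formula
  | or   : Formula → Formula → Formula
  | imp  : Formula → Formula → Formula
  | K    : Formula → Formula

namespace Formula
def neg (A : Formula) : Formula := A.imp bot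
def iff (A B : Formula) : Formula := (A.imp B).and (B.imp A)
end Formula

open Formula

/-- Hilbert-style derivability. `Deriv false` is IEL⁻ (intuitionistic
propositional axioms, distribution `K(A→B) → (KA→KB)`, co-reflection `A → KA`,
modus ponens); `Deriv true` is IEL, which additionally has intuitionistic
reflection `KA → ¬¬A`. -/
inductive Deriv : Bool → Formula → Prop
  | a1 {b : Bool} {A B : Formula} : Deriv b (A.imp (B.imp A))
  | a2 {b : Bool} {A B C : Formula} :
      Deriv b ((A.imp (B.imp C)).imp ((A.imp B).imp (A.imp C)))
  | a3 {b : Bool} {A B : Formula} : Deriv b ((A.and B).imp A)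
  | a4 {b : Bool} {A B : Formula} : Deriv b ((A.and B).imp B)
  | a5 {b : Bool} {A B : Formula} : Deriv b (A.imp (B.imp (A.and B)))
  | a6 {b : Bool} {A B : Formula} : Deriv b (A.imp (A.or B))
  | a7 {b : Bool} {A B : Formula} : Deriv b (B.imp (A.or B))
  | a8 {b : Bool} {A B C : Formula} :
      Deriv b ((A.imp C).imp ((B.imp C).imp ((A.or B).imp C)))
  | a9 {b : Bool} {A : Formula} : Deriv b (Formula.bot.imp A)
  | dist {b : Bool} {A B : Formula} :
      Deriv b ((K (A.imp B)).imp ((K A).imp (K B)))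
  | coref {b : Bool} {A : Formula} : Deriv b (A.imp (K A))
  | ir {A : Formula} : Deriv true ((K A).imp A.neg.neg)
  | mp {b : Bool} {A B : Formula} : Deriv b (A.imp B) → Deriv b A → Deriv b B

namespace Deriv

variable {b : Bool} {A B C : Formula}

theorem mp_under (h : Deriv b (C.imp (A.imp B))) (h' : Deriv b (C.imp A)) :
    Deriv b (C.imp B) :=
  mp (mp a2 h) h'

theorem imp_trans (h : Deriv b (A.imp B)) (h' : Deriv b (B.imp C)) :
    Deriv b (A.imp C) :=
  mp_under (mp a1 h') h

theorem neg_imp_neg (h : Deriv b (A.imp B)) : Deriv b (B.neg.imp A.neg) :=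
  mp_under (imp_trans a1 a2) (mp a1 h)

end Deriv

theorem no_truth_unverifiable : ∀ A : Formula,
    Deriv true ((K A).neg.and (K A.neg).neg).neg := fun _ =>
  .mp_under (.imp_trans .a4 (.neg_imp_neg .coref)) (.imp_trans .a3 (.neg_imp_neg .coref))
end

section
/- Weak disjunction property for verifications: for L ∈ {IEL⁻, IEL} and all formulas A, B, if L ⊢ K(A ∨ B) then L ⊢ K A or L ⊢ K B. -/
open Formula

/-- The Kleene slash for `Deriv b`, extended to the epistemic operator by letting
`K A` be slashed exactly when `A` is. -/
def Slash (b : Bool) : Formula → Prop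
  | .atom _ => False
  | .bot => False
  | .and A B => Slash b A ∧ Slash b B
  | .or A B => Slash b A ∨ Slash b B
  | .imp A B => Deriv b (A.imp B) ∧ (Slash b A → Slash b B)
  | .K A => Slash b A

theorem Slash.deriv {b : Bool} {A : Formula} (h : Slash b A) : Deriv b A := by
  induction A with
  | atom _ => exact h.elim
  | bot => exact h.elim
  | and A B ihA ihB => exact .mp (.mp .a5 (ihA h.1)) (ihB h.2)
  | or A B ihA ihB => exact h.elim (fun h => .mp .a6 (ihA h)) (fun h => .mp .a7 (ihB h))
  | imp A B => exact h.1
  | K A ih => exact .mp .coref (ih h)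

theorem Deriv.slash {b : Bool} {A : Formula} (h : Deriv b A) : Slash b A := by
  induction h with
  | a1 => exact ⟨.a1, fun h => ⟨.mp .a1 h.deriv, fun _ => h⟩⟩
  | a2 =>
    exact ⟨.a2, fun h => ⟨.mp .a2 h.1, fun g =>
      ⟨.mp (.mp .a2 h.1) g.1, fun x => (h.2 x).2 (g.2 x)⟩⟩⟩
  | a3 => exact ⟨.a3, fun h => h.1⟩
  | a4 => exact ⟨.a4, fun h => h.2⟩
  | a5 => exact ⟨.a5, fun h => ⟨.mp .a5 h.deriv, fun g => ⟨h, g⟩⟩⟩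
  | a6 => exact ⟨.a6, Or.inl⟩
  | a7 => exact ⟨.a7, Or.inr⟩
  | a8 =>
    exact ⟨.a8, fun h => ⟨.mp .a8 h.1, fun g =>
      ⟨.mp (.mp .a8 h.1) g.1, fun x => x.elim h.2 g.2⟩⟩⟩
  | a9 => exact ⟨.a9, False.elim⟩
  | dist => exact ⟨.dist, fun h => ⟨.mp .dist (.mp .coref h.1), h.2⟩⟩
  | coref => exact ⟨.coref, id⟩
  | ir => exact ⟨.ir, fun h => ⟨.mp .ir (.mp .coref (Slash.deriv h)), fun g => g.2 h⟩⟩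
  | mp _ _ ihf iha => exact ihf.2 iha

theorem weak_K_disjunction_property : ∀ (b : Bool) (A B : Formula),
    Deriv b (K (A.or B)) → Deriv b (K A) ∨ Deriv b (K B) := by
  intro b A B h
  have hs : Slash b A ∨ Slash b B := h.slash
  exact hs.imp (fun h => .mp .coref h.deriv) (fun h => .mp .coref h.deriv)
end
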